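/- arXiv:2111.04853 — 5 statements merged into one kernel-verified Lean document; each statement's English description precedes it below -/
import Mathlib

section
/- Let k be a commutative ring, f = Σ_{i=0}^4 a_i x^i y^{4−i} a binary quartic over k, and M = [[a,b],[c,d]] a 2×2 matrix over k. Then the quartic invariants transform by ξ₀(f^M) = (ad−bc)⁴ · ξ₀(f) and ξ₁(f^M) = (ad−bc)⁶ · ξ₁(f). -/
open MvPolynomial

/-- The binary form of degree `d` with coefficient tuple `a`:
`f(x,y) = Σ_{i=0}^d a_i x^i y^{d-i}`, as a polynomial in `x = X 0`, `y = X 1`. -/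
noncomputable def binForm {k : Type*} [CommRing k] (d : ℕ) (a : Fin (d + 1) → k) :
    MvPolynomial (Fin 2) k :=
  ∑ i : Fin (d + 1), C (a i) * X 0 ^ (i : ℕ) * X 1 ^ (d - (i : ℕ))

/-- The coefficient tuple of the transformed form
`f^M(x,y) = f(M₀₀x + M₀₁y, M₁₀x + M₁₁y)`:  `transCoeff M d a i` is the coefficient
of `x^i y^{d-i}` in `f^M`. -/
noncomputable def transCoeff {k : Type*} [CommRing k] (M : Matrix (Fin 2) (Fin 2) k)
    (d : ℕ) (a : Fin (d + 1) → k) : Fin (d + 1) → k :=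
  fun i => MvPolynomial.coeff
    (Finsupp.single (0 : Fin 2) (i : ℕ) + Finsupp.single (1 : Fin 2) (d - (i : ℕ)))
    (MvPolynomial.bind₁ (fun j : Fin 2 => C (M j 0) * X 0 + C (M j 1) * X 1) (binForm d a))

/-- The degree 2 invariant ξ₀ of a binary quartic. -/
def quarticXi0 {k : Type*} [CommRing k] (a : Fin 5 → k) : k :=
  12 * a 0 * a 4 - 3 * a 1 * a 3 + a 2 ^ 2

/-- The degree 3 invariant ξ₁ of a binary quartic. -/
def quarticXi1 {k : Type*} [CommRing k] (a : Fin 5 → k) : k :=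
  72 * a 0 * a 2 * a 4 - 27 * a 0 * a 3 ^ 2 - 27 * a 1 ^ 2 * a 4
    + 9 * a 1 * a 2 * a 3 - 2 * a 2 ^ 3

lemma coeff_binForm_aux {k : Type*} [CommRing k] (d : ℕ) (b : Fin (d + 1) → k) (i : Fin (d + 1)) :
    MvPolynomial.coeff
      (Finsupp.single (0 : Fin 2) (i : ℕ) + Finsupp.single (1 : Fin 2) (d - (i : ℕ)))
      (binForm d b) = b i := by
  have hm : ∀ j : Fin (d + 1), (C (b j) * X 0 ^ (j : ℕ) * X 1 ^ (d - (j : ℕ)) :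
      MvPolynomial (Fin 2) k) = monomial
        (Finsupp.single (0 : Fin 2) (j : ℕ) + Finsupp.single (1 : Fin 2) (d - (j : ℕ))) (b j) := by
    intro j
    rw [X_pow_eq_monomial, X_pow_eq_monomial, C_mul_monomial, monomial_mul, mul_one, mul_one]
  unfold binForm
  rw [coeff_sum, Finset.sum_eq_single i]
  · rw [hm, coeff_monomial, if_pos rfl]
  · intro j _ hj
    rw [hm, coeff_monomial, if_neg]
    intro h
    have h0 := DFunLike.congr_fun h 0
    simp at h0
    exact hj (Fin.ext h0)
  · simp

/-- explicit coefficients of the transformed quartic -/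
def quarticTrans {k : Type*} [CommRing k] (p q r s : k) (a : Fin 5 → k) : Fin 5 → k :=
  ![a 0 * s^4 + a 1 * q * s^3 + a 2 * q^2 * s^2 + a 3 * q^3 * s + a 4 * q^4,
    a 0 * (4 * r * s^3) + a 1 * (p * s^3 + 3 * q * r * s^2)
      + a 2 * (2 * p * q * s^2 + 2 * q^2 * r * s) + a 3 * (3 * p * q^2 * s + q^3 * r)
      + a 4 * (4 * p * q^3),
    a 0 * (6 * r^2 * s^2) + a 1 * (3 * p * r * s^2 + 3 * q * r^2 * s)
      + a 2 * (p^2 * s^2 + 4 * p * q * r * s + q^2 * r^2)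
      + a 3 * (3 * p^2 * q * s + 3 * p * q^2 * r) + a 4 * (6 * p^2 * q^2),
    a 0 * (4 * r^3 * s) + a 1 * (3 * p * r^2 * s + q * r^3)
      + a 2 * (2 * p^2 * r * s + 2 * p * q * r^2) + a 3 * (p^3 * s + 3 * p^2 * q * r)
      + a 4 * (4 * p^3 * q),
    a 0 * r^4 + a 1 * p * r^3 + a 2 * p^2 * r^2 + a 3 * p^3 * r + a 4 * p^4]

lemma transCoeff_four {k : Type*} [CommRing k] (a : Fin 5 → k) (M : Matrix (Fin 2) (Fin 2) k) :
    transCoeff M 4 a = quarticTrans (M 0 0) (M 0 1) (M 1 0) (M 1 1) a := by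
  have h : MvPolynomial.bind₁ (fun j : Fin 2 => C (M j 0) * X 0 + C (M j 1) * X 1) (binForm 4 a)
      = binForm 4 (quarticTrans (M 0 0) (M 0 1) (M 1 0) (M 1 1) a) := by
    have h2 : (C (2 : k) : MvPolynomial (Fin 2) k) = 2 := map_ofNat C 2
    have h3 : (C (3 : k) : MvPolynomial (Fin 2) k) = 3 := map_ofNat C 3
    have h4 : (C (4 : k) : MvPolynomial (Fin 2) k) = 4 := map_ofNat C 4
    have h6 : (C (6 : k) : MvPolynomial (Fin 2) k) = 6 := map_ofNat C 6
    simp [binForm, Fin.sum_univ_five, quarticTrans, h2, h3, h4, h6]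
    ring
  funext i
  unfold transCoeff
  rw [h, coeff_binForm_aux]

/-- for a binary quartic `f` over a commutative ring `k` and a 2×2 matrix
`M`, the quartic invariants transform by `ξ₀(f^M) = (det M)⁴ ξ₀(f)` and
`ξ₁(f^M) = (det M)⁶ ξ₁(f)`. -/
theorem quartic_invariants_transformation {k : Type*} [CommRing k]
    (a : Fin 5 → k) (M : Matrix (Fin 2) (Fin 2) k) :
    quarticXi0 (transCoeff M 4 a) = M.det ^ 4 * quarticXi0 a ∧
    quarticXi1 (transCoeff M 4 a) = M.det ^ 6 * quarticXi1 a := by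
  rw [transCoeff_four, Matrix.det_fin_two]
  generalize M 0 0 = p
  generalize M 0 1 = q
  generalize M 1 0 = r
  generalize M 1 1 = s
  constructor
  · simp [quarticXi0, quarticTrans]
    ring
  · simp [quarticXi1, quarticTrans]
    ring
end

section
/- Let k be a commutative ring, f = Σ_{i=0}^6 a_i x^i y^{6−i} a binary sextic over k, and M = [[a,b],[c,d]] a 2×2 matrix over k. Then the sextic invariants transform by ξ₀(f^M) = (ad−bc)⁶ · ξ₀(f) and ξ₁(f^M) = (ad−bc)¹² · ξ₁(f). -/
open MvPolynomial

/-- The degree 2 invariant ξ₀ of a binary sextic. -/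
def sexticXi0 {k : Type*} [CommRing k] (a : Fin 7 → k) : k :=
  120 * a 0 * a 6 - 20 * a 1 * a 5 + 8 * a 2 * a 4 - 3 * a 3 ^ 2

/-- The degree 4 invariant ξ₁ of a binary sextic. -/
def sexticXi1 {k : Type*} [CommRing k] (a : Fin 7 → k) : k :=
  7500 * a 0 ^ 2 * a 6 ^ 2 - 2500 * a 0 * a 1 * a 5 * a 6 - 200 * a 0 * a 2 * a 4 * a 6
    + 500 * a 0 * a 2 * a 5 ^ 2 + 300 * a 0 * a 3 ^ 2 * a 6 - 300 * a 0 * a 3 * a 4 * a 5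
    + 80 * a 0 * a 4 ^ 3 + 500 * a 1 ^ 2 * a 4 * a 6 - 300 * a 1 * a 2 * a 3 * a 6
    - 100 * a 1 * a 2 * a 4 * a 5 + 100 * a 1 * a 3 ^ 2 * a 5 - 20 * a 1 * a 3 * a 4 ^ 2
    + 80 * a 2 ^ 3 * a 6 - 20 * a 2 ^ 2 * a 3 * a 5 + 28 * a 2 ^ 2 * a 4 ^ 2
    - 16 * a 2 * a 3 ^ 2 * a 4 + 3 * a 3 ^ 4

set_option maxHeartbeats 4000000 in
/-- Explicit coefficient 0 of the transformed sextic. -/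
def sexC0 {k : Type*} [CommRing k] (A B C D : k) (a : Fin 7 → k) : k :=
  1 * a 0 * (A ^ 0 * B ^ 0) * (C ^ 0 * D ^ 6)
    + 1 * a 1 * (A ^ 0 * B ^ 1) * (C ^ 0 * D ^ 5)
    + 1 * a 2 * (A ^ 0 * B ^ 2) * (C ^ 0 * D ^ 4)
    + 1 * a 3 * (A ^ 0 * B ^ 3) * (C ^ 0 * D ^ 3)
    + 1 * a 4 * (A ^ 0 * B ^ 4) * (C ^ 0 * D ^ 2)
    + 1 * a 5 * (A ^ 0 * B ^ 5) * (C ^ 0 * D ^ 1)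
    + 1 * a 6 * (A ^ 0 * B ^ 6) * (C ^ 0 * D ^ 0)

set_option maxHeartbeats 4000000 in
/-- Explicit coefficient 1 of the transformed sextic. -/
def sexC1 {k : Type*} [CommRing k] (A B C D : k) (a : Fin 7 → k) : k :=
  6 * a 0 * (A ^ 0 * B ^ 0) * (C ^ 1 * D ^ 5)
    + 5 * a 1 * (A ^ 0 * B ^ 1) * (C ^ 1 * D ^ 4)
    + 1 * a 1 * (A ^ 1 * B ^ 0) * (C ^ 0 * D ^ 5)
    + 4 * a 2 * (A ^ 0 * B ^ 2) * (C ^ 1 * D ^ 3)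
    + 2 * a 2 * (A ^ 1 * B ^ 1) * (C ^ 0 * D ^ 4)
    + 3 * a 3 * (A ^ 0 * B ^ 3) * (C ^ 1 * D ^ 2)
    + 3 * a 3 * (A ^ 1 * B ^ 2) * (C ^ 0 * D ^ 3)
    + 2 * a 4 * (A ^ 0 * B ^ 4) * (C ^ 1 * D ^ 1)
    + 4 * a 4 * (A ^ 1 * B ^ 3) * (C ^ 0 * D ^ 2)
    + 1 * a 5 * (A ^ 0 * B ^ 5) * (C ^ 1 * D ^ 0)
    + 5 * a 5 * (A ^ 1 * B ^ 4) * (C ^ 0 * D ^ 1)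
    + 6 * a 6 * (A ^ 1 * B ^ 5) * (C ^ 0 * D ^ 0)

set_option maxHeartbeats 4000000 in
/-- Explicit coefficient 2 of the transformed sextic. -/
def sexC2 {k : Type*} [CommRing k] (A B C D : k) (a : Fin 7 → k) : k :=
  15 * a 0 * (A ^ 0 * B ^ 0) * (C ^ 2 * D ^ 4)
    + 10 * a 1 * (A ^ 0 * B ^ 1) * (C ^ 2 * D ^ 3)
    + 5 * a 1 * (A ^ 1 * B ^ 0) * (C ^ 1 * D ^ 4)
    + 6 * a 2 * (A ^ 0 * B ^ 2) * (C ^ 2 * D ^ 2)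
    + 8 * a 2 * (A ^ 1 * B ^ 1) * (C ^ 1 * D ^ 3)
    + 1 * a 2 * (A ^ 2 * B ^ 0) * (C ^ 0 * D ^ 4)
    + 3 * a 3 * (A ^ 0 * B ^ 3) * (C ^ 2 * D ^ 1)
    + 9 * a 3 * (A ^ 1 * B ^ 2) * (C ^ 1 * D ^ 2)
    + 3 * a 3 * (A ^ 2 * B ^ 1) * (C ^ 0 * D ^ 3)
    + 1 * a 4 * (A ^ 0 * B ^ 4) * (C ^ 2 * D ^ 0)
    + 8 * a 4 * (A ^ 1 * B ^ 3) * (C ^ 1 * D ^ 1)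
    + 6 * a 4 * (A ^ 2 * B ^ 2) * (C ^ 0 * D ^ 2)
    + 5 * a 5 * (A ^ 1 * B ^ 4) * (C ^ 1 * D ^ 0)
    + 10 * a 5 * (A ^ 2 * B ^ 3) * (C ^ 0 * D ^ 1)
    + 15 * a 6 * (A ^ 2 * B ^ 4) * (C ^ 0 * D ^ 0)

set_option maxHeartbeats 4000000 in
/-- Explicit coefficient 3 of the transformed sextic. -/
def sexC3 {k : Type*} [CommRing k] (A B C D : k) (a : Fin 7 → k) : k :=
  20 * a 0 * (A ^ 0 * B ^ 0) * (C ^ 3 * D ^ 3)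
    + 10 * a 1 * (A ^ 0 * B ^ 1) * (C ^ 3 * D ^ 2)
    + 10 * a 1 * (A ^ 1 * B ^ 0) * (C ^ 2 * D ^ 3)
    + 4 * a 2 * (A ^ 0 * B ^ 2) * (C ^ 3 * D ^ 1)
    + 12 * a 2 * (A ^ 1 * B ^ 1) * (C ^ 2 * D ^ 2)
    + 4 * a 2 * (A ^ 2 * B ^ 0) * (C ^ 1 * D ^ 3)
    + 1 * a 3 * (A ^ 0 * B ^ 3) * (C ^ 3 * D ^ 0)
    + 9 * a 3 * (A ^ 1 * B ^ 2) * (C ^ 2 * D ^ 1)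
    + 9 * a 3 * (A ^ 2 * B ^ 1) * (C ^ 1 * D ^ 2)
    + 1 * a 3 * (A ^ 3 * B ^ 0) * (C ^ 0 * D ^ 3)
    + 4 * a 4 * (A ^ 1 * B ^ 3) * (C ^ 2 * D ^ 0)
    + 12 * a 4 * (A ^ 2 * B ^ 2) * (C ^ 1 * D ^ 1)
    + 4 * a 4 * (A ^ 3 * B ^ 1) * (C ^ 0 * D ^ 2)
    + 10 * a 5 * (A ^ 2 * B ^ 3) * (C ^ 1 * D ^ 0)
    + 10 * a 5 * (A ^ 3 * B ^ 2) * (C ^ 0 * D ^ 1)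
    + 20 * a 6 * (A ^ 3 * B ^ 3) * (C ^ 0 * D ^ 0)

set_option maxHeartbeats 4000000 in
/-- Explicit coefficient 4 of the transformed sextic. -/
def sexC4 {k : Type*} [CommRing k] (A B C D : k) (a : Fin 7 → k) : k :=
  15 * a 0 * (A ^ 0 * B ^ 0) * (C ^ 4 * D ^ 2)
    + 5 * a 1 * (A ^ 0 * B ^ 1) * (C ^ 4 * D ^ 1)
    + 10 * a 1 * (A ^ 1 * B ^ 0) * (C ^ 3 * D ^ 2)
    + 1 * a 2 * (A ^ 0 * B ^ 2) * (C ^ 4 * D ^ 0)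
    + 8 * a 2 * (A ^ 1 * B ^ 1) * (C ^ 3 * D ^ 1)
    + 6 * a 2 * (A ^ 2 * B ^ 0) * (C ^ 2 * D ^ 2)
    + 3 * a 3 * (A ^ 1 * B ^ 2) * (C ^ 3 * D ^ 0)
    + 9 * a 3 * (A ^ 2 * B ^ 1) * (C ^ 2 * D ^ 1)
    + 3 * a 3 * (A ^ 3 * B ^ 0) * (C ^ 1 * D ^ 2)
    + 6 * a 4 * (A ^ 2 * B ^ 2) * (C ^ 2 * D ^ 0)
    + 8 * a 4 * (A ^ 3 * B ^ 1) * (C ^ 1 * D ^ 1)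
    + 1 * a 4 * (A ^ 4 * B ^ 0) * (C ^ 0 * D ^ 2)
    + 10 * a 5 * (A ^ 3 * B ^ 2) * (C ^ 1 * D ^ 0)
    + 5 * a 5 * (A ^ 4 * B ^ 1) * (C ^ 0 * D ^ 1)
    + 15 * a 6 * (A ^ 4 * B ^ 2) * (C ^ 0 * D ^ 0)

set_option maxHeartbeats 4000000 in
/-- Explicit coefficient 5 of the transformed sextic. -/
def sexC5 {k : Type*} [CommRing k] (A B C D : k) (a : Fin 7 → k) : k :=
  6 * a 0 * (A ^ 0 * B ^ 0) * (C ^ 5 * D ^ 1)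
    + 1 * a 1 * (A ^ 0 * B ^ 1) * (C ^ 5 * D ^ 0)
    + 5 * a 1 * (A ^ 1 * B ^ 0) * (C ^ 4 * D ^ 1)
    + 2 * a 2 * (A ^ 1 * B ^ 1) * (C ^ 4 * D ^ 0)
    + 4 * a 2 * (A ^ 2 * B ^ 0) * (C ^ 3 * D ^ 1)
    + 3 * a 3 * (A ^ 2 * B ^ 1) * (C ^ 3 * D ^ 0)
    + 3 * a 3 * (A ^ 3 * B ^ 0) * (C ^ 2 * D ^ 1)
    + 4 * a 4 * (A ^ 3 * B ^ 1) * (C ^ 2 * D ^ 0)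
    + 2 * a 4 * (A ^ 4 * B ^ 0) * (C ^ 1 * D ^ 1)
    + 5 * a 5 * (A ^ 4 * B ^ 1) * (C ^ 1 * D ^ 0)
    + 1 * a 5 * (A ^ 5 * B ^ 0) * (C ^ 0 * D ^ 1)
    + 6 * a 6 * (A ^ 5 * B ^ 1) * (C ^ 0 * D ^ 0)

set_option maxHeartbeats 4000000 in
/-- Explicit coefficient 6 of the transformed sextic. -/
def sexC6 {k : Type*} [CommRing k] (A B C D : k) (a : Fin 7 → k) : k :=
  1 * a 0 * (A ^ 0 * B ^ 0) * (C ^ 6 * D ^ 0)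
    + 1 * a 1 * (A ^ 1 * B ^ 0) * (C ^ 5 * D ^ 0)
    + 1 * a 2 * (A ^ 2 * B ^ 0) * (C ^ 4 * D ^ 0)
    + 1 * a 3 * (A ^ 3 * B ^ 0) * (C ^ 3 * D ^ 0)
    + 1 * a 4 * (A ^ 4 * B ^ 0) * (C ^ 2 * D ^ 0)
    + 1 * a 5 * (A ^ 5 * B ^ 0) * (C ^ 1 * D ^ 0)
    + 1 * a 6 * (A ^ 6 * B ^ 0) * (C ^ 0 * D ^ 0)

/-- Explicit coefficients of the transformed sextic. -/
def sexT {k : Type*} [CommRing k] (A B C D : k) (a : Fin 7 → k) : Fin 7 → k :=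
  ![sexC0 A B C D a, sexC1 A B C D a, sexC2 A B C D a, sexC3 A B C D a, sexC4 A B C D a, sexC5 A B C D a, sexC6 A B C D a]

theorem coeff_binForm {k : Type*} [CommRing k] (d : ℕ) (a : Fin (d + 1) → k) (i : Fin (d + 1)) :
    MvPolynomial.coeff (Finsupp.single (0 : Fin 2) (i : ℕ) + Finsupp.single (1 : Fin 2) (d - (i : ℕ)))
      (binForm d a) = a i := by
  unfold binForm
  rw [MvPolynomial.coeff_sum, Finset.sum_eq_single i]
  · rw [mul_assoc, MvPolynomial.coeff_C_mul, X_pow_eq_monomial, X_pow_eq_monomial,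
      monomial_mul, coeff_monomial]
    simp
  · intro j _ hj
    rw [mul_assoc, MvPolynomial.coeff_C_mul, X_pow_eq_monomial, X_pow_eq_monomial,
      monomial_mul, coeff_monomial, if_neg, mul_zero]
    intro h
    apply hj
    have := DFunLike.congr_fun h 0
    simp at this
    exact Fin.ext this
  · simp

theorem binForm_six {k : Type*} [CommRing k] (a : Fin 7 → k) :
    binForm 6 a = C (a 0) * X 0 ^ 0 * X 1 ^ 6 + C (a 1) * X 0 ^ 1 * X 1 ^ 5
      + C (a 2) * X 0 ^ 2 * X 1 ^ 4 + C (a 3) * X 0 ^ 3 * X 1 ^ 3 + C (a 4) * X 0 ^ 4 * X 1 ^ 2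
      + C (a 5) * X 0 ^ 5 * X 1 ^ 1 + C (a 6) * X 0 ^ 6 * X 1 ^ 0 := by
  unfold binForm
  exact Fin.sum_univ_seven _

set_option maxHeartbeats 4000000 in
theorem transCoeff_eq {k : Type*} [CommRing k] (M : Matrix (Fin 2) (Fin 2) k) (a : Fin 7 → k) :
    transCoeff M 6 a = sexT (M 0 0) (M 0 1) (M 1 0) (M 1 1) a := by
  have key : MvPolynomial.bind₁ (fun j : Fin 2 => C (M j 0) * X 0 + C (M j 1) * X 1) (binForm 6 a)
      = binForm 6 (sexT (M 0 0) (M 0 1) (M 1 0) (M 1 1) a) := by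
    simp only [binForm_six, map_add, map_mul, map_pow, bind₁_X_right, bind₁_C_right]
    have hn : ∀ (n : ℕ) [n.AtLeastTwo],
        (C (OfNat.ofNat n : k) : MvPolynomial (Fin 2) k) = OfNat.ofNat n :=
      fun n _ => map_ofNat C n
    simp [sexC0, sexC1, sexC2, sexC3, sexC4, sexC5, sexC6, sexT, hn]
    ring
  funext i
  unfold transCoeff
  rw [key, coeff_binForm]

set_option maxHeartbeats 4000000 in
theorem sexT_comp {k : Type*} [CommRing k] (A B C D u v : k) (a : Fin 7 → k) :
    sexT 1 u 0 v (sexT A B C D a) = sexT A (A * u + B * v) C (C * u + D * v) a := by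
  funext i
  fin_cases i <;> simp [sexC0, sexC1, sexC2, sexC3, sexC4, sexC5, sexC6, sexT] <;> ring

set_option maxHeartbeats 4000000 in
theorem xi0_upper {k : Type*} [CommRing k] (u v : k) (a : Fin 7 → k) :
    sexticXi0 (sexT 1 u 0 v a) = v ^ 6 * sexticXi0 a := by
  simp [sexC0, sexC1, sexC2, sexC3, sexC4, sexC5, sexC6, sexT, sexticXi0]
  ring

set_option maxHeartbeats 4000000 in
theorem xi1_upper {k : Type*} [CommRing k] (u v : k) (a : Fin 7 → k) :
    sexticXi1 (sexT 1 u 0 v a) = v ^ 12 * sexticXi1 a := by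
  simp [sexC0, sexC1, sexC2, sexC3, sexC4, sexC5, sexC6, sexT, sexticXi1]
  ring

set_option maxHeartbeats 4000000 in
theorem xi0_lower {k : Type*} [CommRing k] (u v w : k) (a : Fin 7 → k) :
    sexticXi0 (sexT u 0 v w a) = (u * w) ^ 6 * sexticXi0 a := by
  simp [sexC0, sexC1, sexC2, sexC3, sexC4, sexC5, sexC6, sexT, sexticXi0]
  ring

set_option maxHeartbeats 4000000 in
theorem xi1_lower {k : Type*} [CommRing k] (u v w : k) (a : Fin 7 → k) :
    sexticXi1 (sexT u 0 v w a) = (u * w) ^ 12 * sexticXi1 a := by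
  simp [sexC0, sexC1, sexC2, sexC3, sexC4, sexC5, sexC6, sexT, sexticXi1]
  ring

/-- The identities up to a power of the upper left entry. -/
theorem xi_weak {k : Type*} [CommRing k] (A B C D : k) (a : Fin 7 → k) :
    A ^ 6 * sexticXi0 (sexT A B C D a) = A ^ 6 * ((A * D - B * C) ^ 6 * sexticXi0 a) ∧
    A ^ 12 * sexticXi1 (sexT A B C D a) = A ^ 12 * ((A * D - B * C) ^ 12 * sexticXi1 a) := by
  have h := sexT_comp A B C D (-B) A a
  have e1 : A * -B + B * A = 0 := by ring
  have e2 : C * -B + D * A = A * D - B * C := by ring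
  rw [e1, e2] at h
  constructor
  · rw [← xi0_upper (-B), h, xi0_lower]; ring
  · rw [← xi1_upper (-B), h, xi1_lower]; ring

theorem sexT_map {k l : Type*} [CommRing k] [CommRing l] (φ : k →+* l) (A B C D : k)
    (a : Fin 7 → k) :
    (fun i => φ (sexT A B C D a i)) = sexT (φ A) (φ B) (φ C) (φ D) (fun i => φ (a i)) := by
  have hn : ∀ (n : ℕ) [n.AtLeastTwo], φ (OfNat.ofNat n : k) = OfNat.ofNat n :=
    fun n _ => map_ofNat φ n
  funext i
  fin_cases i <;> simp [sexC0, sexC1, sexC2, sexC3, sexC4, sexC5, sexC6, sexT, hn]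

theorem xi0_map {k l : Type*} [CommRing k] [CommRing l] (φ : k →+* l) (a : Fin 7 → k) :
    φ (sexticXi0 a) = sexticXi0 (fun i => φ (a i)) := by
  have hn : ∀ (n : ℕ) [n.AtLeastTwo], φ (OfNat.ofNat n : k) = OfNat.ofNat n :=
    fun n _ => map_ofNat φ n
  simp [sexticXi0, hn]

theorem xi1_map {k l : Type*} [CommRing k] [CommRing l] (φ : k →+* l) (a : Fin 7 → k) :
    φ (sexticXi1 a) = sexticXi1 (fun i => φ (a i)) := by
  have hn : ∀ (n : ℕ) [n.AtLeastTwo], φ (OfNat.ofNat n : k) = OfNat.ofNat n :=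
    fun n _ => map_ofNat φ n
  simp [sexticXi1, hn]

theorem xi_strong {k : Type*} [CommRing k] (A B C D : k) (a : Fin 7 → k) :
    sexticXi0 (sexT A B C D a) = (A * D - B * C) ^ 6 * sexticXi0 a ∧
    sexticXi1 (sexT A B C D a) = (A * D - B * C) ^ 12 * sexticXi1 a := by
  have hm : (Polynomial.X + Polynomial.C A).Monic := Polynomial.monic_X_add_C A
  obtain ⟨h0, h1⟩ := xi_weak (Polynomial.X + Polynomial.C A) (Polynomial.C B) (Polynomial.C C)
    (Polynomial.C D) (fun i => Polynomial.C (a i))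
  have h0' := (hm.pow 6).isRegular.left h0
  have h1' := (hm.pow 12).isRegular.left h1
  have g0 := congrArg (Polynomial.evalRingHom (0 : k)) h0'
  have g1 := congrArg (Polynomial.evalRingHom (0 : k)) h1'
  rw [map_mul, xi0_map, xi0_map, sexT_map] at g0
  rw [map_mul, xi1_map, xi1_map, sexT_map] at g1
  constructor
  · simpa using g0
  · simpa using g1

/-- for a binary sextic `f` over a commutative ring `k` and a 2×2 matrix
`M`, the sextic invariants transform by `ξ₀(f^M) = (det M)⁶ ξ₀(f)` and
`ξ₁(f^M) = (det M)¹² ξ₁(f)`. -/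
theorem sextic_invariants_transformation {k : Type*} [CommRing k]
    (a : Fin 7 → k) (M : Matrix (Fin 2) (Fin 2) k) :
    sexticXi0 (transCoeff M 6 a) = M.det ^ 6 * sexticXi0 a ∧
    sexticXi1 (transCoeff M 6 a) = M.det ^ 12 * sexticXi1 a := by
  rw [transCoeff_eq, Matrix.det_fin_two]
  exact xi_strong _ _ _ _ a
end

section
/- Let k be an infinite field and d = 2m an even positive integer. Let I be a homogeneous SL₂(k)-invariant of degree s ≥ 1 for binary forms of degree d over k. If f = Σ_{i=0}^{d} a_i x^i y^{d−i} is a binary form of degree d over k with a_i = 0 for all i < m (equivalently, x^m divides f), then I(f) = a_m^s · I(x^m y^m), where I(x^m y^m) denotes I evaluated at the coefficient tuple of the form x^m y^m. -/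
open MvPolynomial

/-- `I ∈ k[a₀, …, a_d]` is a homogeneous `SL₂(k)`-invariant of degree `s` for binary
forms of degree `d`: it is homogeneous of degree `s` in the coefficient variables and
`I(f^M) = I(f)` for every binary form `f` of degree `d` and every `M ∈ SL₂(k)`. -/
def IsBinaryInvariant {k : Type*} [CommRing k] (d s : ℕ) (I : MvPolynomial (Fin (d + 1)) k) :
    Prop :=
  I.IsHomogeneous s ∧
    ∀ (a : Fin (d + 1) → k) (M : Matrix (Fin 2) (Fin 2) k), M.det = 1 →
      MvPolynomial.eval (transCoeff M d a) I = MvPolynomial.eval a I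


lemma transCoeff_diag {k : Type*} [Field k] (d : ℕ) (a : Fin (d + 1) → k) (t u : k)
    (i : Fin (d + 1)) :
    transCoeff !![t, 0; 0, u] d a i = a i * t ^ (i : ℕ) * u ^ (d - (i : ℕ)) := by
  classical
  unfold transCoeff binForm
  have key : ∀ j : Fin (d + 1),
      bind₁ (fun j : Fin 2 => C ((!![t, 0; 0, u] : Matrix (Fin 2) (Fin 2) k) j 0) * X 0
        + C ((!![t, 0; 0, u] : Matrix (Fin 2) (Fin 2) k) j 1) * X 1)
        (C (a j) * X 0 ^ (j : ℕ) * X 1 ^ (d - (j : ℕ)) : MvPolynomial (Fin 2) k)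
      = monomial (Finsupp.single (0 : Fin 2) (j : ℕ) + Finsupp.single (1 : Fin 2) (d - (j : ℕ)))
          (a j * t ^ (j : ℕ) * u ^ (d - (j : ℕ))) := by
    intro j
    simp only [map_mul, map_pow, bind₁_X_right, algHom_C, algebraMap_eq]
    simp only [Matrix.of_apply, Matrix.cons_val_zero, Matrix.cons_val_one, Matrix.cons_val',
      Matrix.cons_val_fin_one, map_zero, zero_mul, add_zero, zero_add]
    rw [← mul_one (a j * t ^ (j : ℕ) * u ^ (d - (j : ℕ))), ← C_mul_monomial,
      ← one_mul (1 : k), ← monomial_mul, ← X_pow_eq_monomial, ← X_pow_eq_monomial]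
    simp only [map_mul, map_pow, mul_pow]
    ring
  rw [map_sum, Finset.sum_congr rfl (fun j _ => key j), coeff_sum]
  rw [Finset.sum_eq_single i]
  · rw [coeff_monomial, if_pos rfl]
  · intro j _ hj
    rw [coeff_monomial, if_neg]
    intro h
    apply hj
    have := DFunLike.congr_fun h 0
    simp at this
    exact Fin.ext this
  · simp

/-- let `k` be an infinite field and `d = 2m` an even positive integer.
If `f = Σ a_i x^i y^{d-i}` has `a_i = 0` for all `i < m` (i.e. `x^m ∣ f`), then every
homogeneous `SL₂(k)`-invariant `I` of degree `s ≥ 1` satisfies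
`I(f) = a_m ^ s · I(x^m y^m)`, where `x^m y^m` has coefficient tuple `δ_{i,m}`. -/
theorem invariant_of_form_divisible_by_middle_power {k : Type*} [Field k] [Infinite k]
    (m s : ℕ) (hm : 1 ≤ m) (hs : 1 ≤ s)
    (I : MvPolynomial (Fin (2 * m + 1)) k) (hI : IsBinaryInvariant (2 * m) s I)
    (a : Fin (2 * m + 1) → k) (ha : ∀ i : Fin (2 * m + 1), (i : ℕ) < m → a i = 0) :
    MvPolynomial.eval a I =
      a ⟨m, by omega⟩ ^ s *
        MvPolynomial.eval (fun i : Fin (2 * m + 1) => if (i : ℕ) = m then (1 : k) else 0) I := by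
  classical
  obtain ⟨hh, hinv⟩ := hI
  set P : Polynomial k :=
    aeval (fun i : Fin (2 * m + 1) =>
      Polynomial.C (a i) * Polynomial.X ^ (2 * ((i : ℕ) - m))) I with hP
  have hev : ∀ t : k, P.eval t
      = MvPolynomial.eval (fun i : Fin (2 * m + 1) => a i * t ^ (2 * ((i : ℕ) - m))) I := by
    intro t
    rw [hP, ← Polynomial.coe_aeval_eq_eval, ← MvPolynomial.coe_aeval_eq_eval]
    change (Polynomial.aeval t) _ = aeval _ I
    rw [← AlgHom.comp_apply, MvPolynomial.comp_aeval]
    simp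
  have hne : ∀ t : k, t ≠ 0 → P.eval t = MvPolynomial.eval a I := by
    intro t ht
    rw [hev, ← hinv a !![t, 0; 0, t⁻¹] (by simp [Matrix.det_fin_two, ht])]
    congr 2
    funext i
    rw [transCoeff_diag]
    by_cases h : (i : ℕ) < m
    · simp [ha i h]
    · rw [mul_assoc]
      congr 1
      have hi := i.2
      have e : t ^ (i : ℕ) = t ^ (2 * ((i : ℕ) - m)) * t ^ (2 * m - (i : ℕ)) := by
        rw [← pow_add]; congr 1; omega
      rw [e, mul_assoc, ← mul_pow, mul_inv_cancel₀ ht, one_pow, mul_one]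
  have hPC : P = Polynomial.C (MvPolynomial.eval a I) := by
    apply Polynomial.eq_of_infinite_eval_eq
    refine Set.Infinite.mono (s := {0}ᶜ) ?_ (Set.finite_singleton (0 : k)).infinite_compl
    intro t ht
    simpa using hne t ht
  have h0 := hev 0
  rw [hPC, Polynomial.eval_C] at h0
  rw [h0]
  have hfun : (fun i : Fin (2 * m + 1) => a i * (0 : k) ^ (2 * ((i : ℕ) - m)))
      = a ⟨m, by omega⟩ • (fun i : Fin (2 * m + 1) => if (i : ℕ) = m then (1 : k) else 0) := by
    funext i
    simp only [Pi.smul_apply, smul_eq_mul]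
    rcases lt_trichotomy (i : ℕ) m with h | h | h
    · simp [ha i h, h.ne]
    · have : i = ⟨m, by omega⟩ := Fin.ext h
      rw [if_pos h, mul_one, h, Nat.sub_self, mul_zero, pow_zero, mul_one, this]
    · rw [zero_pow (by omega), if_neg h.ne']; simp
  rw [hfun]
  rw [MvPolynomial.eval_eq', MvPolynomial.eval_eq', Finset.mul_sum]
  refine Finset.sum_congr rfl fun e he => ?_
  have hdeg : ∑ i, e i = s := by
    have h1 := hh (mem_support_iff.mp he)
    rwa [Finsupp.weight_apply, Finsupp.sum_fintype _ _ (by simp),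
      Finset.sum_congr rfl (fun i _ => by simp : ∀ i ∈ Finset.univ, e i • (1 : Fin (2 * m + 1) → ℕ) i = e i)] at h1
  simp only [Pi.smul_apply, smul_eq_mul, mul_pow, Finset.prod_mul_distrib]
  rw [Finset.prod_pow_eq_pow_sum, hdeg]
  ring
end

section
/- Let k be an algebraically closed field with char k ∉ {2,3}, and let f be a nonzero binary quartic over k. Then ξ₀(f) = 0 and ξ₁(f) = 0 if and only if f has a linear factor of multiplicity at least 3, i.e., there is a nonzero linear form ℓ ∈ k[x,y] with ℓ³ dividing f. -/
open MvPolynomial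

theorem xi_of_factor {k : Type*} [Field k] (b : Fin 5 → k) (u v : k) (hu : u ≠ 0)
    (h : (Polynomial.C u * Polynomial.X + Polynomial.C v) ^ 3 ∣
      ∑ i : Fin 5, Polynomial.C (b i) * Polynomial.X ^ (i : ℕ)) :
    quarticXi0 b = 0 ∧ quarticXi1 b = 0 := by
  obtain ⟨g, hg⟩ := h
  have hl : (Polynomial.C u * Polynomial.X + Polynomial.C v).natDegree = 1 :=
    Polynomial.natDegree_linear hu
  have hl0 : (Polynomial.C u * Polynomial.X + Polynomial.C v) ≠ 0 := by
    intro h0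
    rw [h0] at hl
    simp at hl
  have hdeg : (∑ i : Fin 5, Polynomial.C (b i) * Polynomial.X ^ (i : ℕ)).natDegree ≤ 4 := by
    apply Polynomial.natDegree_sum_le_of_forall_le
    intro i _
    exact (Polynomial.natDegree_C_mul_X_pow_le _ _).trans (by omega)
  have hg1 : g.natDegree ≤ 1 := by
    by_cases g0 : g = 0
    · simp [g0]
    rw [hg, Polynomial.natDegree_mul (pow_ne_zero _ hl0) g0, Polynomial.natDegree_pow, hl] at hdeg
    omega
  obtain ⟨c, d, rfl⟩ := Polynomial.exists_eq_X_add_C_of_natDegree_le_one hg1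
  have e : (Polynomial.C u * Polynomial.X + Polynomial.C v) ^ 3 *
      (Polynomial.C c * Polynomial.X + Polynomial.C d) =
      Polynomial.C (v ^ 3 * d) + Polynomial.C (3 * u * v ^ 2 * d + v ^ 3 * c) * Polynomial.X
      + Polynomial.C (3 * u ^ 2 * v * d + 3 * u * v ^ 2 * c) * Polynomial.X ^ 2
      + Polynomial.C (u ^ 3 * d + 3 * u ^ 2 * v * c) * Polynomial.X ^ 3
      + Polynomial.C (u ^ 3 * c) * Polynomial.X ^ 4 := by
    simp only [map_mul, map_add, map_pow, Polynomial.C_ofNat]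
    ring
  rw [e] at hg
  have h0 := congrArg (fun p => Polynomial.coeff p 0) hg
  have h1 := congrArg (fun p => Polynomial.coeff p 1) hg
  have h2 := congrArg (fun p => Polynomial.coeff p 2) hg
  have h3 := congrArg (fun p => Polynomial.coeff p 3) hg
  have h4 := congrArg (fun p => Polynomial.coeff p 4) hg
  simp only [Fin.sum_univ_five, Polynomial.coeff_add, Polynomial.coeff_C_mul,
    Polynomial.coeff_X_pow, Polynomial.coeff_C, Polynomial.coeff_X] at h0 h1 h2 h3 h4
  norm_num [Fin.ext_iff] at h0 h1 h2 h3 h4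
  unfold quarticXi0 quarticXi1
  rw [h0, h1, h2, h3, h4]
  constructor <;> ring

theorem factor_monic {k : Type*} [Field k] [IsAlgClosed k] (h2 : (2 : k) ≠ 0) (h3 : (3 : k) ≠ 0)
    (a0 a1 a2 a3 c : k) (hc : c ≠ 0)
    (e0 : 12 * a0 * c - 3 * a1 * a3 + a2 ^ 2 = 0)
    (e1 : 72 * a0 * a2 * c - 27 * a0 * a3 ^ 2 - 27 * a1 ^ 2 * c
      + 9 * a1 * a2 * a3 - 2 * a2 ^ 3 = 0) :
    ∃ r q : k, a3 = -c * (3 * r + q) ∧ a2 = c * (3 * r ^ 2 + 3 * r * q) ∧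
      a1 = -c * (r ^ 3 + 3 * r ^ 2 * q) ∧ a0 = c * r ^ 3 * q := by
  have h4 : (4 : k) ≠ 0 := by
    have : (4 : k) = 2 * 2 := by norm_num
    rw [this]; exact mul_ne_zero h2 h2
  have h6 : (6 : k) ≠ 0 := by
    have : (6 : k) = 2 * 3 := by norm_num
    rw [this]; exact mul_ne_zero h2 h3
  obtain ⟨s, hs⟩ : ∃ s, a3 = c * (-4 * s) := ⟨-a3 / (4 * c), by field_simp⟩
  obtain ⟨P, hP⟩ : ∃ P, a2 = c * (P + 6 * s ^ 2) := ⟨a2 / c - 6 * s ^ 2, by field_simp; ring⟩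
  obtain ⟨Q, hQ⟩ : ∃ Q, a1 = c * (Q - 2 * P * s - 4 * s ^ 3) :=
    ⟨a1 / c + 2 * P * s + 4 * s ^ 3, by field_simp; ring⟩
  obtain ⟨R, hR⟩ : ∃ R, a0 = c * (R - Q * s + P * s ^ 2 + s ^ 4) :=
    ⟨a0 / c + Q * s - P * s ^ 2 - s ^ 4, by field_simp; ring⟩
  subst hs hP hQ hR
  have f0 : 12 * R + P ^ 2 = 0 := by
    have : c ^ 2 * (12 * R + P ^ 2) = 0 := by linear_combination e0
    exact (mul_eq_zero.mp this).resolve_left (pow_ne_zero _ hc)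
  have f1 : 72 * P * R - 27 * Q ^ 2 - 2 * P ^ 3 = 0 := by
    have : c ^ 3 * (72 * P * R - 27 * Q ^ 2 - 2 * P ^ 3) = 0 := by linear_combination e1
    exact (mul_eq_zero.mp this).resolve_left (pow_ne_zero _ hc)
  obtain ⟨β, hβ⟩ := IsAlgClosed.exists_pow_nat_eq (-P / 6) (n := 2) (by norm_num)
  have hPβ : P = -6 * β ^ 2 := by rw [hβ]; field_simp
  have hQβ : (Q - 8 * β ^ 3) * (Q + 8 * β ^ 3) = 0 := by
    have : (3 : k) ^ 3 * ((Q - 8 * β ^ 3) * (Q + 8 * β ^ 3)) = 0 := by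
      rw [hPβ] at f0 f1
      linear_combination -f1 - 36 * β ^ 2 * f0
    exact (mul_eq_zero.mp this).resolve_left (pow_ne_zero _ h3)
  obtain ⟨α, hPα, hQα⟩ : ∃ α, P = -6 * α ^ 2 ∧ Q = 8 * α ^ 3 := by
    rcases mul_eq_zero.mp hQβ with h | h
    · exact ⟨β, hPβ, by linear_combination h⟩
    · exact ⟨-β, by rw [hPβ]; ring, by linear_combination h⟩
  have hRα : R = -3 * α ^ 4 := by
    have : (2 : k) ^ 2 * 3 * (R + 3 * α ^ 4) = 0 := by
      rw [hPα] at f0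
      linear_combination f0
    have := (mul_eq_zero.mp this).resolve_left (mul_ne_zero (pow_ne_zero _ h2) h3)
    linear_combination this
  subst hPα hQα hRα
  refine ⟨s + α, s - 3 * α, ?_, ?_, ?_, ?_⟩ <;> ring

/-- over an algebraically closed field `k` with `char k ∉ {2,3}`, a nonzero
binary quartic `f` satisfies `ξ₀(f) = 0` and `ξ₁(f) = 0` if and only if `f` has a linear
factor of multiplicity at least `3`. -/
theorem quartic_invariants_vanish_iff_triple_factor {k : Type*} [Field k] [IsAlgClosed k]
    (hchar2 : ringChar k ≠ 2) (hchar3 : ringChar k ≠ 3)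
    (a : Fin 5 → k) (ha : a ≠ 0) :
    (quarticXi0 a = 0 ∧ quarticXi1 a = 0) ↔
      ∃ u v : k, (u, v) ≠ (0, 0) ∧ (C u * X 0 + C v * X 1) ^ 3 ∣ binForm 4 a := by
  have h2 : (2 : k) ≠ 0 := Ring.two_ne_zero hchar2
  have h3 : (3 : k) ≠ 0 := by
    intro h
    have h' : ((3 : ℕ) : k) = 0 := by exact_mod_cast h
    rcases (Nat.dvd_prime Nat.prime_three).mp ((ringChar.spec k 3).mp h') with h1 | h1
    · exact CharP.ringChar_ne_one h1
    · exact hchar3 h1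
  have hf : binForm 4 a = C (a 0) * X 1 ^ 4 + C (a 1) * X 0 * X 1 ^ 3
      + C (a 2) * X 0 ^ 2 * X 1 ^ 2 + C (a 3) * X 0 ^ 3 * X 1 + C (a 4) * X 0 ^ 4 := by
    simp [binForm, Fin.sum_univ_five]
  constructor
  · rintro ⟨e0, e1⟩
    unfold quarticXi0 at e0
    unfold quarticXi1 at e1
    by_cases h4 : a 4 = 0
    · by_cases h30 : a 3 = 0
      · have h20 : a 2 = 0 := by
          rw [h4, h30] at e0
          simpa using e0
        refine ⟨0, 1, by simp, C (a 0) * X 1 + C (a 1) * X 0, ?_⟩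
        rw [hf, h4, h30, h20]
        simp only [map_zero, map_one]
        ring
      · obtain ⟨m, hm⟩ : ∃ m, a 2 = 3 * a 3 * m := ⟨a 2 / (3 * a 3), by field_simp⟩
        have hm1 : a 1 = 3 * a 3 * m ^ 2 := by
          have : (3 * a 3) * (a 1 - 3 * a 3 * m ^ 2) = 0 := by
            rw [hm, h4] at e0
            linear_combination -e0
          have := (mul_eq_zero.mp this).resolve_left (mul_ne_zero h3 h30)
          linear_combination this
        have hm0 : a 0 = a 3 * m ^ 3 := by
          have : (3 ^ 3 * a 3 ^ 2) * (a 0 - a 3 * m ^ 3) = 0 := by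
            rw [hm, h4, hm1] at e1
            linear_combination -e1
          have := (mul_eq_zero.mp this).resolve_left
            (mul_ne_zero (pow_ne_zero _ h3) (pow_ne_zero _ h30))
          linear_combination this
        refine ⟨1, m, by simp, C (a 3) * X 1, ?_⟩
        rw [hf, h4, hm0, hm1, hm]
        simp only [map_mul, map_pow, map_zero, map_one, map_ofNat]
        ring
    · obtain ⟨r, q, g3, g2, g1, g0⟩ := factor_monic h2 h3 _ _ _ _ _ h4 e0 e1
      refine ⟨1, -r, by simp, C (a 4) * (X 0 - C q * X 1), ?_⟩
      rw [hf, g3, g2, g1, g0]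
      simp only [map_mul, map_pow, map_add, map_neg, map_one, map_ofNat]
      ring
  · rintro ⟨u, v, huv, hd⟩
    rw [hf] at hd
    by_cases hu : u = 0
    · have hv : v ≠ 0 := by
        rintro rfl
        exact huv (by rw [hu])
      have hd' := map_dvd (aeval (R := k) ![(1 : Polynomial k), Polynomial.X]) hd
      have := xi_of_factor ![a 4, a 3, a 2, a 1, a 0] v u hv (by
        convert hd' using 1
        · simp [Polynomial.C_eq_algebraMap, add_comm]
        · simp [Fin.sum_univ_five, Polynomial.C_eq_algebraMap]
          ring)
      simp only [quarticXi0, quarticXi1] at this ⊢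
      simp at this
      constructor
      · linear_combination this.1
      · linear_combination this.2
    · have hd' := map_dvd (aeval (R := k) ![Polynomial.X, (1 : Polynomial k)]) hd
      apply xi_of_factor a u v hu
      convert hd' using 1
      · simp [Polynomial.C_eq_algebraMap]
      · simp [Fin.sum_univ_five, Polynomial.C_eq_algebraMap]
end

section
/- Let p ≥ 5 be a prime and f ∈ ℤ[x,y] a binary quartic whose coefficients are not all divisible by p. Then p divides both ξ₀(f) and ξ₁(f) if and only if the reduction of f modulo p, regarded as a binary quartic over an algebraic closure of 𝔽_p, has a linear factor of multiplicity at least 3. In particular, f is semistable over ℚ_p if and only if p does not divide gcd(ξ₀(f), ξ₁(f)). -/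
open MvPolynomial

lemma binForm_four {k : Type*} [CommRing k] (a : Fin 5 → k) :
    binForm 4 a = C (a 0) * X 1 ^ 4 + C (a 1) * X 0 * X 1 ^ 3 + C (a 2) * X 0 ^ 2 * X 1 ^ 2
      + C (a 3) * X 0 ^ 3 * X 1 + C (a 4) * X 0 ^ 4 := by
  simp [binForm, Fin.sum_univ_succ]
  ring_nf

lemma quartic_forward {K : Type*} [Field K] [IsAlgClosed K] (h3 : (3 : K) ≠ 0)
    (a : Fin 5 → K) (h0 : quarticXi0 a = 0) (h1 : quarticXi1 a = 0) :
    ∃ u v : K, (u, v) ≠ (0, 0) ∧ (C u * X 0 + C v * X 1) ^ 3 ∣ binForm 4 a := by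
  rw [binForm_four]
  unfold quarticXi0 at h0
  unfold quarticXi1 at h1
  generalize a 0 = a0 at *
  generalize a 1 = a1 at *
  generalize a 2 = a2 at *
  generalize a 3 = a3 at *
  generalize a 4 = a4 at *
  by_cases h4 : a4 = 0
  · subst h4
    by_cases h3' : a3 = 0
    · subst h3'
      have : a2 = 0 := by
        have : a2 ^ 2 = 0 := by linear_combination h0
        simpa using this
      subst this
      refine ⟨0, 1, by simp, C a0 * X 1 + C a1 * X 0, ?_⟩
      simp only [map_zero, map_one]
      ring
    · obtain ⟨s, hs⟩ : ∃ s, a2 = 3 * a3 * s := ⟨a2 / (3 * a3), by field_simp⟩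
      subst hs
      have e1 : a1 = 3 * a3 * s ^ 2 := by
        apply mul_left_cancel₀ (mul_ne_zero h3 h3')
        linear_combination -h0
      subst e1
      have e0 : a0 = a3 * s ^ 3 := by
        apply mul_left_cancel₀ (mul_ne_zero (pow_ne_zero 3 h3) (pow_ne_zero 2 h3'))
        linear_combination -h1
      subst e0
      refine ⟨1, s, by simp, C a3 * X 1, ?_⟩
      simp only [map_mul, map_pow, map_one, map_ofNat, map_zero]
      ring
  · obtain ⟨t, ht⟩ : ∃ t, a4 * t ^ 4 + a3 * t ^ 3 + a2 * t ^ 2 + a1 * t + a0 = 0 := by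
      obtain ⟨t, ht⟩ := IsAlgClosed.exists_root
        (Polynomial.C a4 * Polynomial.X ^ 4 + Polynomial.C a3 * Polynomial.X ^ 3
          + Polynomial.C a2 * Polynomial.X ^ 2 + Polynomial.C a1 * Polynomial.X
          + Polynomial.C a0) (by
          have : (Polynomial.C a4 * Polynomial.X ^ 4 + Polynomial.C a3 * Polynomial.X ^ 3
          + Polynomial.C a2 * Polynomial.X ^ 2 + Polynomial.C a1 * Polynomial.X
          + Polynomial.C a0).degree = 4 := by compute_degree!
          rw [this]; norm_num)
      exact ⟨t, by simpa using ht⟩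
    obtain ⟨c3, hc3⟩ : ∃ c, c = a4 := ⟨_, rfl⟩
    obtain ⟨c2, hc2⟩ : ∃ c, c = a3 + 4 * t * a4 := ⟨_, rfl⟩
    obtain ⟨c1, hc1⟩ : ∃ c, c = a2 + 3 * t * a3 + 6 * t ^ 2 * a4 := ⟨_, rfl⟩
    obtain ⟨c0, hc0⟩ : ∃ c, c = a1 + 2 * t * a2 + 3 * t ^ 2 * a3 + 4 * t ^ 3 * a4 := ⟨_, rfl⟩
    obtain rfl : a4 = c3 := hc3.symm
    obtain rfl : a3 = c2 - 4 * t * a4 := by linear_combination -hc2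
    obtain rfl : a2 = c1 - 3 * t * c2 + 6 * t ^ 2 * a4 := by linear_combination -hc1
    obtain rfl : a1 = c0 - 2 * t * c1 + 3 * t ^ 2 * c2 - 4 * t ^ 3 * a4 := by
      linear_combination -hc0
    obtain rfl : a0 = - t * c0 + t ^ 2 * c1 - t ^ 3 * c2 + t ^ 4 * a4 := by
      linear_combination ht
    clear hc0 hc1 hc2 hc3 ht
    have h0' : c1 ^ 2 = 3 * c0 * c2 := by linear_combination h0
    have h1' : -27 * c0 ^ 2 * a4 + 9 * c0 * c1 * c2 - 2 * c1 ^ 3 = 0 := by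
      linear_combination h1
    clear h0 h1
    by_cases hc : c0 = 0
    · subst hc
      have : c1 = 0 := by
        have : c1 ^ 2 = 0 := by linear_combination h0'
        simpa using this
      subst this
      refine ⟨1, -t, by simp, C c2 * X 1 + C a4 * (X 0 - C t * X 1), ?_⟩
      simp only [map_mul, map_pow, map_one, map_ofNat, map_add, map_sub, map_neg, map_zero]
      ring
    · obtain ⟨s, hs⟩ : ∃ s, c1 = 3 * c0 * s := ⟨c1 / (3 * c0), by field_simp⟩
      subst hs
      obtain rfl : c2 = 3 * c0 * s ^ 2 := by
        apply mul_left_cancel₀ (mul_ne_zero h3 hc)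
        linear_combination -h0'
      obtain rfl : a4 = c0 * s ^ 3 := by
        apply mul_left_cancel₀ (mul_ne_zero (pow_ne_zero 3 h3) (pow_ne_zero 2 hc))
        linear_combination -h1'
      refine ⟨s, 1 - s * t, ?_, C c0 * (X 0 - C t * X 1), ?_⟩
      · intro h
        simp only [Prod.mk.injEq] at h
        obtain ⟨rfl, h⟩ := h
        simp at h
      simp only [map_mul, map_pow, map_one, map_ofNat, map_add, map_sub, map_neg, map_zero]
      ring

lemma quartic_backward {K : Type*} [Field K]
    (a : Fin 5 → K) (u v : K) (huv : (u, v) ≠ (0, 0))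
    (h : (C u * X 0 + C v * X 1) ^ 3 ∣ binForm 4 a) :
    quarticXi0 a = 0 ∧ quarticXi1 a = 0 := by
  rw [binForm_four] at h
  unfold quarticXi0 quarticXi1
  generalize a 0 = a0 at *
  generalize a 1 = a1 at *
  generalize a 2 = a2 at *
  generalize a 3 = a3 at *
  generalize a 4 = a4 at *
  by_cases hu : u = 0
  · subst hu
    have hv : v ≠ 0 := by rintro rfl; exact huv rfl
    have h' := map_dvd (aeval (![1, Polynomial.X] : Fin 2 → Polynomial K)) h
    simp only [map_add, map_mul, map_pow, aeval_X, aeval_C, Matrix.cons_val_zero,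
      Matrix.cons_val_one, Polynomial.algebraMap_eq, map_zero, zero_mul, zero_add] at h'
    have h2 := (Dvd.intro_left _ (mul_pow _ _ _).symm).trans h'
    rw [Polynomial.X_pow_dvd_iff] at h2
    have e0 := h2 0 (by norm_num)
    have e1 := h2 1 (by norm_num)
    have e2 := h2 2 (by norm_num)
    simp [Polynomial.coeff_X, Polynomial.coeff_C, Polynomial.coeff_X_pow, Polynomial.coeff_one] at e0 e1 e2
    subst e0 e1 e2
    constructor <;> ring
  · have h' := map_dvd (aeval (![Polynomial.X, 1] : Fin 2 → Polynomial K)) h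
    simp only [map_add, map_mul, map_pow, aeval_X, aeval_C, Matrix.cons_val_zero,
      Matrix.cons_val_one, Polynomial.algebraMap_eq, one_pow, mul_one] at h'
    obtain ⟨q, hq⟩ := h'
    have hL : (Polynomial.C u * Polynomial.X + Polynomial.C v).natDegree = 1 := by
      compute_degree!
    have hL0 : (Polynomial.C u * Polynomial.X + Polynomial.C v) ≠ 0 := by
      intro h; rw [h] at hL; simp at hL
    have hd : q.natDegree ≤ 1 := by
      by_cases hq0 : q = 0
      · simp [hq0]
      have e := congrArg Polynomial.natDegree hq
      rw [Polynomial.natDegree_mul (pow_ne_zero _ hL0) hq0, Polynomial.natDegree_pow, hL] at e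
      have : (Polynomial.C a0 + Polynomial.C a1 * Polynomial.X + Polynomial.C a2 * Polynomial.X ^ 2
        + Polynomial.C a3 * Polynomial.X ^ 3 + Polynomial.C a4 * Polynomial.X ^ 4).natDegree ≤ 4 := by
        compute_degree!
      omega
    obtain ⟨m, n, rfl⟩ := Polynomial.exists_eq_X_add_C_of_natDegree_le_one hd
    have hq' : Polynomial.C a0 + Polynomial.C a1 * Polynomial.X + Polynomial.C a2 * Polynomial.X ^ 2
        + Polynomial.C a3 * Polynomial.X ^ 3 + Polynomial.C a4 * Polynomial.X ^ 4 =
        Polynomial.C (v ^ 3 * n) + Polynomial.C (3 * u * v ^ 2 * n + v ^ 3 * m) * Polynomial.X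
        + Polynomial.C (3 * u ^ 2 * v * n + 3 * u * v ^ 2 * m) * Polynomial.X ^ 2
        + Polynomial.C (u ^ 3 * n + 3 * u ^ 2 * v * m) * Polynomial.X ^ 3
        + Polynomial.C (u ^ 3 * m) * Polynomial.X ^ 4 := by
      rw [hq]
      simp only [map_mul, map_pow, map_ofNat, map_add]
      ring
    have e (i : ℕ) := congrArg (fun P => Polynomial.coeff P i) hq'
    have e0 := e 0
    have e1 := e 1
    have e2 := e 2
    have e3 := e 3
    have e4 := e 4
    clear e hq hq' h
    simp only [Polynomial.coeff_add, Polynomial.coeff_C_mul, Polynomial.coeff_X,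
      Polynomial.coeff_C, Polynomial.coeff_X_pow] at e0 e1 e2 e3 e4
    norm_num at e0 e1 e2 e3 e4
    subst e0 e1 e2 e3 e4
    constructor <;> ring

/-- let `p ≥ 5` be prime and `f ∈ ℤ[x,y]` a binary quartic whose
coefficients are not all divisible by `p`.  Then `p` divides both `ξ₀(f)` and `ξ₁(f)` if
and only if the reduction of `f` mod `p`, viewed over an algebraic closure of `𝔽_p`, has
a linear factor of multiplicity at least `3`.  In particular, `f` is semistable over
`ℚ_p` (i.e. its reduction mod `p` has no root of multiplicity `> 2`) if and only if
`p ∤ gcd(ξ₀(f), ξ₁(f))`. -/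
theorem quartic_semistable_mod_p_iff {p : ℕ} [Fact p.Prime] (hp5 : 5 ≤ p)
    (a : Fin 5 → ℤ) (ha : ¬ ∀ i, (p : ℤ) ∣ a i) :
    (((p : ℤ) ∣ quarticXi0 a ∧ (p : ℤ) ∣ quarticXi1 a) ↔
      ∃ u v : AlgebraicClosure (ZMod p), (u, v) ≠ (0, 0) ∧
        (C u * X 0 + C v * X 1) ^ 3 ∣
          binForm 4 (fun i => (a i : AlgebraicClosure (ZMod p)))) ∧
    ((¬ ∃ u v : AlgebraicClosure (ZMod p), (u, v) ≠ (0, 0) ∧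
        (C u * X 0 + C v * X 1) ^ 3 ∣
          binForm 4 (fun i => (a i : AlgebraicClosure (ZMod p)))) ↔
      ¬ (p : ℤ) ∣ gcd (quarticXi0 a) (quarticXi1 a)) := by

  have key : (((p : ℤ) ∣ quarticXi0 a ∧ (p : ℤ) ∣ quarticXi1 a) ↔
      ∃ u v : AlgebraicClosure (ZMod p), (u, v) ≠ (0, 0) ∧
        (C u * X 0 + C v * X 1) ^ 3 ∣
          binForm 4 (fun i => (a i : AlgebraicClosure (ZMod p)))) := by
    haveI : CharP (AlgebraicClosure (ZMod p)) p :=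
      charP_of_injective_algebraMap (algebraMap (ZMod p) _).injective p
    have h3 : (3 : AlgebraicClosure (ZMod p)) ≠ 0 := by
      intro h
      have h' : ((3 : ℕ) : AlgebraicClosure (ZMod p)) = 0 := by exact_mod_cast h
      rw [CharP.cast_eq_zero_iff _ p] at h'
      have := Nat.le_of_dvd (by norm_num) h'
      omega
    have c0 : ((quarticXi0 a : ℤ) : AlgebraicClosure (ZMod p))
        = quarticXi0 (fun i => (a i : AlgebraicClosure (ZMod p))) := by
      simp [quarticXi0]
    have c1 : ((quarticXi1 a : ℤ) : AlgebraicClosure (ZMod p))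
        = quarticXi1 (fun i => (a i : AlgebraicClosure (ZMod p))) := by
      simp [quarticXi1]
    rw [← CharP.intCast_eq_zero_iff (AlgebraicClosure (ZMod p)) p,
      ← CharP.intCast_eq_zero_iff (AlgebraicClosure (ZMod p)) p, c0, c1]
    constructor
    · rintro ⟨h0, h1⟩
      exact quartic_forward h3 _ h0 h1
    · rintro ⟨u, v, huv, h⟩
      exact quartic_backward _ u v huv h
  refine ⟨key, ?_⟩
  rw [← key, dvd_gcd_iff]
end
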